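/- Let p, w ∈ ℂ^d and let n ∈ ℤ_{≥1}. The linear function ℓ_w(z) := ⟨z,w⟩ = Σ_{i=1}^d z_i·conj(w_i) belongs to the Fock space H, and ‖π_{p,n}ℓ_w − ℓ_w‖_H² ≤ (1+d)·(1+2d)·‖w‖²·‖p‖^{2n}/(n−1)!. -/

import Mathlib

open MeasureTheory Complex Filter Matrix
open scoped BigOperators ENNReal Topology

noncomputable section

namespace PFA

/-- The canonical inclusion of `ℝ^d` into `ℂ^d`. -/
def cpx {d : ℕ} (x : Fin d → ℝ) : Fin d → ℂ := fun i => (x i : ℂ)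

/-- Euclidean norm on `ℂ^d`. -/
def enorm' {d : ℕ} (z : Fin d → ℂ) : ℝ := Real.sqrt (∑ i, ‖z i‖ ^ 2)

/-- An absolutely convex subset of `ℂ^d`. -/
def AbsConvex {d : ℕ} (K : Set (Fin d → ℂ)) : Prop :=
  ∀ x ∈ K, ∀ y ∈ K, ∀ a b : ℂ, ‖a‖ + ‖b‖ ≤ 1 → a • x + b • y ∈ K

/-- The (topological) support of a Borel measure. -/
def msupport {X : Type*} [TopologicalSpace X] [MeasurableSpace X] (μ : Measure X) : Set X :=
  {x | ∀ U : Set X, IsOpen U → x ∈ U → 0 < μ U}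

/-- translate of a set -/
def transSet {d : ℕ} (p : Fin d → ℂ) (K : Set (Fin d → ℂ)) : Set (Fin d → ℂ) :=
  (fun z => p + z) '' K

/-- multi-indices of degree at most `n` -/
abbrev MIdx (d n : ℕ) := {α : Fin d → ℕ // ∑ i, α i ≤ n}

instance instFintypeMIdx (d n : ℕ) : Fintype (MIdx d n) :=
  Fintype.subtype
    ((Fintype.piFinset fun _ : Fin d => Finset.range (n + 1)).filter fun α => ∑ i, α i ≤ n)
    (by
      intro α
      simp only [Finset.mem_filter, Fintype.mem_piFinset, Finset.mem_range, Nat.lt_succ_iff]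
      exact ⟨fun h => h.2, fun h =>
        ⟨fun i => le_trans (Finset.single_le_sum (fun j _ => Nat.zero_le (α j))
          (Finset.mem_univ i)) h, h⟩⟩)

/-- inclusion of multi-index sets -/
def midxIncl {d m n : ℕ} (h : m ≤ n) (a : MIdx d m) : MIdx d n := ⟨a.1, a.2.trans h⟩

/-- moment matrix `D_n(μ)` -/
def momentMatrix (d n : ℕ) (μ : Measure (Fin d → ℝ)) : Matrix (MIdx d n) (MIdx d n) ℝ :=
  Matrix.of fun a b => ∫ x, ∏ i, x i ^ (a.1 i + b.1 i) ∂μ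

/-- smallest eigenvalue of a real matrix -/
def minEig {ι : Type*} [Fintype ι] (M : Matrix ι ι ℝ) : ℝ :=
  sInf {t : ℝ | ∃ v : ι → ℝ, v ≠ 0 ∧ M.mulVec v = t • v}

/-- ℓ²→ℓ² operator norm of a matrix -/
def matOpNorm {𝕜 : Type*} [RCLike 𝕜] {ι κ : Type*} [Fintype ι] [Fintype κ]
    (M : Matrix ι κ 𝕜) : ℝ :=
  sSup {t : ℝ | ∃ v : κ → 𝕜, (∑ j, ‖v j‖ ^ 2) ≤ 1 ∧
    t = Real.sqrt (∑ i, ‖∑ j, M i j * v j‖ ^ 2)}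

/-- Frobenius norm of a matrix -/
def matFrobNorm {𝕜 : Type*} [RCLike 𝕜] {ι κ : Type*} [Fintype ι] [Fintype κ]
    (M : Matrix ι κ 𝕜) : ℝ :=
  Real.sqrt (∑ i, ∑ j, ‖M i j‖ ^ 2)

/-- the four Penrose conditions characterizing the Moore–Penrose pseudo-inverse -/
def IsMoorePenrose {ι κ : Type*} [Fintype ι] [Fintype κ]
    (A : Matrix ι κ ℂ) (X : Matrix κ ι ℂ) : Prop :=
  A * X * A = A ∧ X * A * X = X ∧ (A * X)ᴴ = A * X ∧ (X * A)ᴴ = X * A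

/-- complex partial derivative in the `k`-th coordinate -/
def pderivAt {d : ℕ} (k : Fin d) (g : (Fin d → ℂ) → ℂ) : (Fin d → ℂ) → ℂ :=
  fun z => fderiv ℂ g z (Pi.single k 1)

/-- iterated complex partial derivative `∂^γ` -/
def mpderiv {d : ℕ} (γ : Fin d → ℕ) (g : (Fin d → ℂ) → ℂ) : (Fin d → ℂ) → ℂ :=
  ((List.finRange d).map fun k => (pderivAt k)^[γ k]).foldr (fun F h => F h) g

/-- the jet functional `ν_{q,κ}` -/
def jetFun {d : ℕ} (q : Fin d → ℂ) (κ : Fin d → ℕ) (h : (Fin d → ℂ) → ℂ) : ℂ :=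
  ((Real.exp (-(∑ i, ‖q i‖ ^ 2) / 2) / Real.sqrt (∏ i, (κ i).factorial) : ℝ) : ℂ) *
    ∑ γ ∈ Fintype.piFinset fun i => Finset.range (κ i + 1),
      (∏ i, ((κ i).choose (γ i) : ℂ)) *
        (∏ i, (-(starRingEnd ℂ) (q i)) ^ (κ i - γ i)) * mpderiv γ h q

/-- the functions `u_{p,α}` (also used for `v_{q,β}`) -/
def uFn {d : ℕ} (p : Fin d → ℂ) (α : Fin d → ℕ) (z : Fin d → ℂ) : ℂ :=
  ((Real.exp (-(∑ i, ‖p i‖ ^ 2) / 2) / Real.sqrt (∏ i, (α i).factorial) : ℝ) : ℂ) *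
    (∏ i, (z i - p i) ^ (α i)) * Complex.exp (∑ i, z i * (starRingEnd ℂ) (p i))

/-- sample matrix `U_{p,n,Z}` (resp. `V_{q,n,W}`) -/
def sampMat {d N : ℕ} (n : ℕ) (p : Fin d → ℂ) (Z : Fin N → Fin d → ℂ) :
    Matrix (Fin N) (MIdx d n) ℂ :=
  Matrix.of fun i a => uFn p a.1 (Z i)

/-- Data matrix `Ĉ_{m,n,Z}`, given a Moore–Penrose pseudo-inverse `X` of `U_{p,n,Z}ᴴ`:
the leftmost block of `V_{q,m,W}ᴴ * X`. -/
def dataMat {d r N : ℕ} {m n : ℕ} (hmn : m ≤ n) (q : Fin r → ℂ)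
    (W : Fin N → Fin r → ℂ) (X : Matrix (Fin N) (MIdx d n) ℂ) :
    Matrix (MIdx r m) (MIdx d m) ℂ :=
  ((sampMat m q W)ᴴ * X).submatrix id (midxIncl hmn)

/-- jet representation matrix of the push-forward of `f` at `p` -/
def IsJetMatrix {d r : ℕ} (m : ℕ) (p : Fin d → ℂ) (f : (Fin d → ℂ) → Fin r → ℂ)
    (C : Matrix (MIdx r m) (MIdx d m) ℂ) : Prop :=
  ∀ h : MvPolynomial (Fin r) ℂ, ∀ a : MIdx d m,
    jetFun p a.1 (fun z => MvPolynomial.eval (f z) h) =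
      ∑ b : MIdx r m, C b a * jetFun (f p) b.1 (fun w => MvPolynomial.eval w h)

/-- `π^{-d}` times Lebesgue measure on `ℂ^d` -/
def μE (d : ℕ) : Measure (Fin d → ℂ) := ((ENNReal.ofReal Real.pi) ^ d)⁻¹ • volume

/-- `e_w(z) = exp⟨z,w⟩` -/
def eW {d : ℕ} (w : Fin d → ℂ) (z : Fin d → ℂ) : ℂ :=
  Complex.exp (∑ i, z i * (starRingEnd ℂ) (w i))

/-- supporting function `h_K` -/
def suppFn {d : ℕ} (K : Set (Fin d → ℂ)) (ζ : Fin d → ℂ) : ℝ :=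
  sSup ((fun z => (∑ i, ζ i * (starRingEnd ℂ) (z i)).re) '' K)

/-- polar set `K°` -/
def polarSet {d : ℕ} (K : Set (Fin d → ℂ)) : Set (Fin d → ℂ) :=
  {z | ∀ w ∈ K, ‖∑ i, z i * (starRingEnd ℂ) (w i)‖ ≤ 1}

/-- membership in the Fock space -/
def MemFock {d : ℕ} (h : (Fin d → ℂ) → ℂ) : Prop :=
  Differentiable ℂ h ∧
    Integrable (fun z => ‖h z‖ ^ 2 * Real.exp (-(∑ i, ‖z i‖ ^ 2))) (μE d)

/-- Fock-space inner product -/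
def fockInner {d : ℕ} (h g : (Fin d → ℂ) → ℂ) : ℂ :=
  ∫ z, h z * (starRingEnd ℂ) (g z) * ((Real.exp (-(∑ i, ‖z i‖ ^ 2)) : ℝ) : ℂ) ∂(μE d)

/-- orthogonal projection onto `span{u_{p,α} : |α| ≤ n}`, written out using the
orthonormal system `u_{p,α}` -/
def jetProj {d : ℕ} (n : ℕ) (p : Fin d → ℂ) (g : (Fin d → ℂ) → ℂ) : (Fin d → ℂ) → ℂ :=
  fun z => ∑ a : MIdx d n, fockInner g (uFn p a.1) * uFn p a.1 z


lemma A1 (m : ℕ) {b : ℝ} (hb : 0 < b) :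
    Integrable (fun z : ℂ => ‖z‖ ^ m * Real.exp (-b * ‖z‖ ^ 2)) := by
  have h := Complex.integral_rpow_mul_exp_neg_mul_rpow (p := 2) (q := m) (b := b) (by norm_num)
    (by have : (0:ℝ) ≤ m := by positivity
        linarith) hb
  refine Integrable.of_integral_ne_zero ?_
  have e : (fun z : ℂ => ‖z‖ ^ m * Real.exp (-b * ‖z‖ ^ 2)) =
    fun z : ℂ => ‖z‖ ^ (m:ℝ) * Real.exp (-b * ‖z‖ ^ (2:ℝ)) := by
    ext z; simp
  rw [e, h]
  have : 0 < Real.Gamma (((m:ℝ) + 2) / 2) := Real.Gamma_pos_of_pos (by positivity)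
  positivity

lemma B1 (a : ℕ) : ∫ z : ℂ, (z ^ a * (starRingEnd ℂ) z ^ a * (Real.exp (-‖z‖ ^ 2) : ℂ)) =
    Real.pi * a.factorial := by
  have h := Complex.integral_rpow_mul_exp_neg_rpow (p := 2) (q := ((2 * a : ℕ) : ℝ)) (by norm_num)
    (by have : (0:ℝ) ≤ ((2 * a : ℕ) : ℝ) := by positivity
        linarith)
  have e : (fun z : ℂ => z ^ a * (starRingEnd ℂ) z ^ a * (Real.exp (-‖z‖ ^ 2) : ℂ)) =
    fun z : ℂ => ((‖z‖ ^ ((2 * a : ℕ) : ℝ) * Real.exp (- ‖z‖ ^ (2:ℝ)) : ℝ) : ℂ) := by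
    ext z
    rw [← mul_pow, Complex.mul_conj, Complex.normSq_eq_norm_sq]
    rw [Real.rpow_natCast, Real.rpow_ofNat, pow_mul]
    push_cast; rfl
  rw [e, integral_complex_ofReal, h]
  have : (((2 * a : ℕ) : ℝ) + 2) / 2 = a + 1 := by push_cast; ring
  rw [this, Real.Gamma_nat_eq_factorial]
  push_cast; ring

lemma B2 (a b : ℕ) (hab : a ≠ b) :
    ∫ z : ℂ, (z ^ a * (starRingEnd ℂ) z ^ b * (Real.exp (-‖z‖ ^ 2) : ℂ)) = 0 := by
  set J := ∫ z : ℂ, (z ^ a * (starRingEnd ℂ) z ^ b * (Real.exp (-‖z‖ ^ 2) : ℂ)) with hJ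
  set θ : ℝ := Real.pi / ((a:ℝ) - b) with hθ
  have hne : (a:ℝ) - b ≠ 0 := by rw [sub_ne_zero]; exact_mod_cast hab
  have hmp := (rotation (Circle.exp θ)).measurePreserving
  have h2 := hmp.integral_comp (rotation (Circle.exp θ)).toHomeomorph.measurableEmbedding
    (fun z : ℂ => (z ^ a * (starRingEnd ℂ) z ^ b * (Real.exp (-‖z‖ ^ 2) : ℂ)))
  have hz : Complex.exp (θ * I) ^ a * (starRingEnd ℂ) (Complex.exp (θ * I)) ^ b = -1 := by
    rw [← Complex.exp_conj, ← Complex.exp_nat_mul, ← Complex.exp_nat_mul, ← Complex.exp_add,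
      ← Complex.exp_pi_mul_I]
    congr 1
    have : Real.pi = θ * ((a:ℝ) - b) := by rw [hθ]; field_simp
    rw [this]
    simp
    ring
  have h3 : (fun z : ℂ => (((rotation (Circle.exp θ)) z) ^ a *
      (starRingEnd ℂ) ((rotation (Circle.exp θ)) z) ^ b *
        (Real.exp (-‖(rotation (Circle.exp θ)) z‖ ^ 2) : ℂ))) =
      fun z => -(z ^ a * (starRingEnd ℂ) z ^ b * (Real.exp (-‖z‖ ^ 2) : ℂ)) := by
    ext z
    rw [LinearIsometryEquiv.norm_map, rotation_apply, Circle.coe_exp, map_mul, mul_pow, mul_pow]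
    linear_combination (z ^ a * (starRingEnd ℂ) z ^ b * (Real.exp (-‖z‖ ^ 2) : ℂ)) * hz
  rw [h3, integral_neg, ← hJ] at h2
  exact self_eq_neg.mp h2.symm

lemma C0 (k b : ℕ) (s : ℂ) :
    HasSum (fun j : ℕ => ∫ z : ℂ, s ^ j / j.factorial *
      (z ^ (k + j) * (starRingEnd ℂ) z ^ b * (Real.exp (-‖z‖ ^ 2) : ℂ)))
     (∫ z : ℂ, z ^ k * (starRingEnd ℂ) z ^ b * Complex.exp (s * z) * (Real.exp (-‖z‖ ^ 2) : ℂ)) := by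
  have hs : ∀ z : ℂ, HasSum (fun j : ℕ => ‖z‖ ^ (k + b) * Real.exp (-‖z‖ ^ 2) *
      ((‖s‖ * ‖z‖) ^ j / j.factorial)) (‖z‖ ^ (k + b) * Real.exp (-‖z‖ ^ 2) * Real.exp (‖s‖ * ‖z‖)) := by
    intro z
    refine HasSum.mul_left _ ?_
    rw [Real.exp_eq_exp_ℝ]
    exact NormedSpace.expSeries_div_hasSum_exp _
  refine hasSum_integral_of_dominated_convergence
    (fun j z => ‖z‖ ^ (k + b) * Real.exp (-‖z‖ ^ 2) * ((‖s‖ * ‖z‖) ^ j / j.factorial)) ?_ ?_ ?_ ?_ ?_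
  · intro j
    exact Continuous.aestronglyMeasurable (by fun_prop)
  · intro j
    refine .of_forall fun z => le_of_eq ?_
    simp only [norm_mul, norm_div, norm_pow, Complex.norm_natCast, RCLike.norm_conj,
      Complex.norm_real, Real.norm_eq_abs, Real.abs_exp]
    rw [mul_pow, pow_add, pow_add]; ring
  · exact .of_forall fun z => (hs z).summable
  · simp_rw [fun z => (hs z).tsum_eq]
    refine Integrable.mono' ((A1 (k + b) (b := 1/2) (by norm_num)).const_mul (Real.exp (‖s‖^2/2))) 
      (Continuous.aestronglyMeasurable (by fun_prop)) (.of_forall fun z => ?_)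
    rw [Real.norm_of_nonneg (by positivity), mul_assoc, ← Real.exp_add, mul_left_comm, ← Real.exp_add]
    refine mul_le_mul_of_nonneg_left (Real.exp_le_exp.mpr ?_) (by positivity)
    nlinarith [sq_nonneg (‖s‖ - ‖z‖)]
  · refine .of_forall fun z => ?_
    have h : HasSum (fun j : ℕ => (s * z) ^ j / j.factorial) (Complex.exp (s * z)) := by
      rw [Complex.exp_eq_exp_ℂ]
      exact NormedSpace.expSeries_div_hasSum_exp _
    have h' := h.mul_left (z ^ k * (starRingEnd ℂ) z ^ b * (Real.exp (-‖z‖ ^ 2) : ℂ))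
    have e1 : (fun j : ℕ => s ^ j / j.factorial *
      (z ^ (k + j) * (starRingEnd ℂ) z ^ b * (Real.exp (-‖z‖ ^ 2) : ℂ))) = fun j : ℕ =>
       z ^ k * (starRingEnd ℂ) z ^ b * (Real.exp (-‖z‖ ^ 2) : ℂ) * ((s * z) ^ j / j.factorial) := by
      ext j; rw [mul_pow, pow_add]; ring
    rw [e1]
    convert! h' using 1
    ring

lemma C1 (b : ℕ) (s : ℂ) :
    ∫ z : ℂ, (starRingEnd ℂ) z ^ b * Complex.exp (s * z) * (Real.exp (-‖z‖ ^ 2) : ℂ) =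
      Real.pi * s ^ b := by
  have h := C0 0 b s
  have h2 := hasSum_single (f := fun j : ℕ => ∫ z : ℂ, s ^ j / j.factorial *
      (z ^ (0 + j) * (starRingEnd ℂ) z ^ b * (Real.exp (-‖z‖ ^ 2) : ℂ))) b (by
    intro j hj
    rw [integral_const_mul, B2 _ _ (by omega), mul_zero])
  have h3 := h.unique h2
  simp only [pow_zero, one_mul] at h3
  rw [h3, integral_const_mul, zero_add, B1]
  have : (b.factorial : ℂ) ≠ 0 := by exact_mod_cast b.factorial_ne_zero
  field_simp

lemma C2 (b : ℕ) (s : ℂ) :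
    ∫ z : ℂ, z * (starRingEnd ℂ) z ^ b * Complex.exp (s * z) * (Real.exp (-‖z‖ ^ 2) : ℂ) =
      Real.pi * (b * s ^ (b - 1)) := by
  have h := C0 1 b s
  simp only [pow_one] at h
  rcases b with _ | b
  · rw [← h.tsum_eq]
    rw [tsum_congr (g := fun _ => (0:ℂ))]
    · simp
    · intro j
      rw [integral_const_mul, B2 _ _ (by omega), mul_zero]
  · have h2 := hasSum_single (f := fun j : ℕ => ∫ z : ℂ, s ^ j / j.factorial *
        (z ^ (1 + j) * (starRingEnd ℂ) z ^ (b + 1) * (Real.exp (-‖z‖ ^ 2) : ℂ))) b (by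
      intro j hj
      rw [integral_const_mul, B2 _ _ (by omega), mul_zero])
    have h3 := h.unique h2
    rw [h3, integral_const_mul, add_comm 1 b, B1, Nat.factorial_succ]
    have : (b.factorial : ℂ) ≠ 0 := by exact_mod_cast b.factorial_ne_zero
    push_cast
    field_simp

/-- integrability used for linearity -/
lemma C3 (k b : ℕ) (s : ℂ) : Integrable (fun z : ℂ =>
    z ^ k * (starRingEnd ℂ) z ^ b * Complex.exp (s * z) * (Real.exp (-‖z‖ ^ 2) : ℂ)) := by
  refine Integrable.mono' ((A1 (k + b) (b := 1/2) (by norm_num)).const_mul (Real.exp (‖s‖^2/2)))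
      (Continuous.aestronglyMeasurable (by fun_prop)) (.of_forall fun z => ?_)
  simp only [norm_mul, norm_div, norm_pow, RCLike.norm_conj,
      Complex.norm_real, Real.norm_eq_abs, Real.abs_exp]
  rw [← pow_add, mul_left_comm, mul_assoc, ← Real.exp_add]
  refine mul_le_mul_of_nonneg_left ?_ (by positivity)
  rw [Complex.norm_exp, ← Real.exp_add]
  refine Real.exp_le_exp.mpr ?_
  have := (Complex.re_le_norm (s * z)).trans (norm_mul_le s z)
  nlinarith [sq_nonneg (‖s‖ - ‖z‖)]

/-- the Gaussian weight after translation -/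
lemma wt (p z : ℂ) : (Real.exp (-‖z + p‖ ^ 2) : ℂ) * Complex.exp ((starRingEnd ℂ) (z + p) * p) =
    Complex.exp (-(starRingEnd ℂ) p * z) * (Real.exp (-‖z‖ ^ 2) : ℂ) := by
  have h : ∀ u : ℂ, ((‖u‖ : ℝ) : ℂ) ^ 2 = u * (starRingEnd ℂ) u := fun u => (Complex.mul_conj' u).symm
  push_cast
  rw [← Complex.exp_add, ← Complex.exp_add, h, h]
  congr 1
  rw [map_add]; ring

lemma wt2 (p z : ℂ) : (Real.exp (-‖z + p‖ ^ 2) : ℂ) * Complex.exp ((starRingEnd ℂ) (z + p) * p) *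
     Complex.exp ((z + p) * (starRingEnd ℂ) p) = 
    Real.exp (‖p‖ ^ 2) * (Real.exp (-‖z‖ ^ 2) : ℂ) := by
  have h : ∀ u : ℂ, ((‖u‖ : ℝ) : ℂ) ^ 2 = u * (starRingEnd ℂ) u := fun u => (Complex.mul_conj' u).symm
  rw [wt]
  push_cast
  rw [← Complex.exp_add, ← Complex.exp_add, ← Complex.exp_add, h, h]
  congr 1
  ring

/-- one-dimensional factor of `u`. -/
def v1 (p : ℂ) (a : ℕ) (z : ℂ) : ℂ := (z - p) ^ a * Complex.exp (z * (starRingEnd ℂ) p)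

lemma v1_conj (p : ℂ) (a : ℕ) (z : ℂ) : (starRingEnd ℂ) (v1 p a (z + p)) = 
    (starRingEnd ℂ) z ^ a * Complex.exp ((starRingEnd ℂ) (z + p) * p) := by
  rw [v1, map_mul, map_pow, ← Complex.exp_conj, map_mul, Complex.conj_conj, add_sub_cancel_right]

lemma D1 (p : ℂ) (a : ℕ) :
    ∫ z : ℂ, (starRingEnd ℂ) (v1 p a z) * (Real.exp (-‖z‖ ^ 2) : ℂ) = 
      Real.pi * (-(starRingEnd ℂ) p) ^ a := by
  rw [← integral_add_right_eq_self _ p, ← C1]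
  congr 1; ext z
  rw [v1_conj]
  linear_combination (starRingEnd ℂ) z ^ a * wt p z

lemma D2 (p : ℂ) (a : ℕ) :
    ∫ z : ℂ, z * (starRingEnd ℂ) (v1 p a z) * (Real.exp (-‖z‖ ^ 2) : ℂ) = 
      Real.pi * (p * (-(starRingEnd ℂ) p) ^ a + a * (-(starRingEnd ℂ) p) ^ (a - 1)) := by
  rw [← integral_add_right_eq_self _ p, mul_add, ← C2, mul_left_comm, ← C1, ← integral_const_mul,
    ← integral_add]
  · congr 1; ext z
    rw [v1_conj]
    linear_combination (z + p) * (starRingEnd ℂ) z ^ a * wt p z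
  · refine Integrable.const_mul ?_ _
    have h := C3 0 a (-(starRingEnd ℂ) p)
    simp only [pow_zero, one_mul] at h
    exact h
  · have h := C3 1 a (-(starRingEnd ℂ) p)
    simp only [pow_one] at h
    exact h

lemma D3 (p : ℂ) (a b : ℕ) :
    ∫ z : ℂ, v1 p a z * (starRingEnd ℂ) (v1 p b z) * (Real.exp (-‖z‖ ^ 2) : ℂ) = 
      if a = b then (Real.pi * a.factorial * Real.exp (‖p‖ ^ 2) : ℂ) else 0 := by
  rw [← integral_add_right_eq_self _ p]
  have : (fun z : ℂ => v1 p a (z + p) * (starRingEnd ℂ) (v1 p b (z + p)) *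
      (Real.exp (-‖z + p‖ ^ 2) : ℂ)) = fun z => (Real.exp (‖p‖ ^ 2) : ℂ) *
      (z ^ a * (starRingEnd ℂ) z ^ b * (Real.exp (-‖z‖ ^ 2) : ℂ)) := by
    ext z
    rw [v1_conj, v1, add_sub_cancel_right]
    linear_combination z ^ a * (starRingEnd ℂ) z ^ b * wt2 p z
  rw [this, integral_const_mul]
  split_ifs with h
  · subst h; rw [B1]; ring
  · rw [B2 _ _ h, mul_zero]

lemma D4 (p : ℂ) (a b : ℕ) :
    Integrable fun z : ℂ => v1 p a z * (starRingEnd ℂ) (v1 p b z) * (Real.exp (-‖z‖ ^ 2) : ℂ) := by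
  have : (fun z : ℂ => v1 p a (z + p) * (starRingEnd ℂ) (v1 p b (z + p)) *
      (Real.exp (-‖z + p‖ ^ 2) : ℂ)) = fun z => (Real.exp (‖p‖ ^ 2) : ℂ) *
      (z ^ a * (starRingEnd ℂ) z ^ b * (Real.exp (-‖z‖ ^ 2) : ℂ)) := by
    ext z
    rw [v1_conj, v1, add_sub_cancel_right]
    linear_combination z ^ a * (starRingEnd ℂ) z ^ b * wt2 p z
  have h : Integrable (fun z : ℂ => v1 p a (z + p) * (starRingEnd ℂ) (v1 p b (z + p)) *
      (Real.exp (-‖z + p‖ ^ 2) : ℂ)) := by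
    rw [this]
    exact Integrable.const_mul (by simpa using C3 a b 0) _
  simpa using h.comp_add_right (-p)

/-- `q^α` -/
def mP {d : ℕ} (q : Fin d → ℂ) (α : Fin d → ℕ) : ℂ := ∏ j, q j ^ α j

/-- `∂_i q^α` -/
def mQ {d : ℕ} (q : Fin d → ℂ) (i : Fin d) (α : Fin d → ℕ) : ℂ :=
  ∏ j, if j = i then (α j : ℂ) * q j ^ (α j - 1) else q j ^ α j

/-- `α!` -/
def mF {d : ℕ} (α : Fin d → ℕ) : ℂ := ∏ j, ((α j).factorial : ℂ)

lemma mF_ne {d : ℕ} (α : Fin d → ℕ) : mF α ≠ 0 :=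
  Finset.prod_ne_zero_iff.mpr fun j _ => by exact_mod_cast (α j).factorial_ne_zero

lemma mP_succ {d : ℕ} (q : Fin d → ℂ) (i : Fin d) (β : Fin d → ℕ) :
    mP q (β + Pi.single i 1) = q i * mP q β := by
  simp only [mP, Pi.add_apply, pow_add, Finset.prod_mul_distrib]
  rw [mul_comm]
  congr 1
  rw [Finset.prod_eq_single i] <;> simp +contextual

lemma mF_succ {d : ℕ} (i : Fin d) (β : Fin d → ℕ) :
    mF (β + Pi.single i 1) = (β i + 1) * mF β := by
  simp only [mF]
  rw [← Finset.mul_prod_erase _ _ (Finset.mem_univ i),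
    ← Finset.mul_prod_erase (Finset.univ) (fun j => ((β j).factorial : ℂ)) (Finset.mem_univ i),
    ← mul_assoc]
  congr 1
  · simp [Nat.factorial_succ]
  · refine Finset.prod_congr rfl fun j hj => ?_
    simp [Finset.ne_of_mem_erase hj]

lemma mQ_eq {d : ℕ} (q : Fin d → ℂ) (i : Fin d) (α : Fin d → ℕ) :
    mQ q i α = α i * q i ^ (α i - 1) * ∏ j ∈ Finset.univ.erase i, q j ^ α j := by
  rw [mQ, ← Finset.mul_prod_erase _ _ (Finset.mem_univ i), if_pos rfl]
  congr 1
  refine Finset.prod_congr rfl fun j hj => ?_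
  rw [if_neg (Finset.ne_of_mem_erase hj)]

lemma mQ_succ_self {d : ℕ} (q : Fin d → ℂ) (i : Fin d) (β : Fin d → ℕ) :
    mQ q i (β + Pi.single i 1) = (β i + 1) * mP q β := by
  rw [mQ_eq, mP, ← Finset.mul_prod_erase _ _ (Finset.mem_univ i), ← mul_assoc]
  congr 1
  · simp
  · refine Finset.prod_congr rfl fun j hj => ?_
    simp [Finset.ne_of_mem_erase hj]

lemma mQ_mul {d : ℕ} (q : Fin d → ℂ) (i : Fin d) (β : Fin d → ℕ) :
    q i * mQ q i β = β i * mP q β := by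
  rw [mQ_eq, mP, ← Finset.mul_prod_erase Finset.univ (fun j => q j ^ β j) (Finset.mem_univ i)]
  have key : q i * (β i * q i ^ (β i - 1)) = β i * q i ^ β i := by
    rcases β i with _ | k
    · simp
    · rw [Nat.add_sub_cancel, pow_succ]; ring
  linear_combination (∏ j ∈ Finset.univ.erase i, q j ^ β j) * key

lemma mQ_succ {d : ℕ} (q : Fin d → ℂ) (i j : Fin d) (β : Fin d → ℕ) :
    mQ q j (β + Pi.single i 1) = q i * mQ q j β + if j = i then mP q β else 0 := by
  split_ifs with h
  · subst h; rw [mQ_succ_self, mQ_mul]; ring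
  · rw [mQ, ← Finset.mul_prod_erase _ _ (Finset.mem_univ i), mQ,
      ← Finset.mul_prod_erase _ _ (Finset.mem_univ i), if_neg (Ne.symm h), if_neg (Ne.symm h),
      add_zero, ← mul_assoc]
    congr 1
    · simp [pow_succ]; ring
    · refine Finset.prod_congr rfl fun k hk => ?_
      simp [Finset.ne_of_mem_erase hk]

lemma shift {d : ℕ} (q : Fin d → ℂ) (i : Fin d) (n : ℕ) (F : (Fin d → ℕ) → ℂ) :
    ∑ a : MIdx d (n + 1), mQ q i a.1 * F a.1 / mF a.1 =
      ∑ b : MIdx d n, mP q b.1 * F (b.1 + Pi.single i 1) / mF b.1 := by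
  symm
  refine Finset.sum_of_injOn (fun b : MIdx d n => (⟨b.1 + Pi.single i 1, by
    simpa [Finset.sum_add_distrib] using b.2⟩ : MIdx d (n + 1))) ?_ ?_ ?_ ?_
  · intro a _ b _ h
    simpa [Subtype.ext_iff] using h
  · intro a _; simp
  · intro a _ ha
    have h0 : a.1 i = 0 := by
      by_contra hne
      apply ha
      have hle : (Pi.single i 1 : Fin d → ℕ) ≤ a.1 := by
        intro j
        by_cases hj : j = i
        · subst hj; simp; omega
        · simp [hj]
      have hadd : (a.1 - Pi.single i 1) + Pi.single i 1 = a.1 := tsub_add_cancel_of_le hle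
      refine ⟨⟨a.1 - Pi.single i 1, ?_⟩, by simp, Subtype.ext hadd⟩
      have h2 := a.2
      rw [← hadd] at h2
      simpa [Finset.sum_add_distrib] using h2
    rw [mQ_eq, h0]; simp
  · intro b _
    have h1 : ((b.1 i : ℂ) + 1) ≠ 0 := by exact_mod_cast Nat.succ_ne_zero (b.1 i)
    have h2 := mF_ne b.1
    simp only [mQ_succ_self, mF_succ]
    field_simp

lemma sum_midx {d n : ℕ} (f : (Fin d → ℕ) → ℂ) :
    ∑ a : MIdx d n, f a.1 =
      ∑ k ∈ Finset.range (n + 1), ∑ α ∈ Finset.piAntidiag Finset.univ k, f α := by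
  rw [← Finset.sum_biUnion]
  · rw [← Finset.sum_subtype]
    intro α
    simp
  · intro a _ b _ hab
    rw [Function.onFun, Finset.disjoint_left]
    intro x hx hy
    simp at hx hy
    exact hab (hx.symm.trans hy)

lemma sum_E {d n : ℕ} (q : Fin d → ℂ) :
    ∑ a : MIdx d n, mP q a.1 * (starRingEnd ℂ) (mP q a.1) / mF a.1 =
      ∑ k ∈ Finset.range (n + 1), (∑ i, q i * (starRingEnd ℂ) (q i)) ^ k / k.factorial := by
  rw [sum_midx (fun a => mP q a * (starRingEnd ℂ) (mP q a) / mF a)]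
  refine Finset.sum_congr rfl fun k _ => ?_
  rw [Finset.sum_pow_eq_sum_piAntidiag, Finset.sum_div]
  refine Finset.sum_congr rfl fun α hα => ?_
  have hs : ∑ i, α i = k := by simpa using hα
  have h := Nat.multinomial_spec Finset.univ α
  rw [hs] at h
  have h' : mF α * (Nat.multinomial Finset.univ α : ℂ) = k.factorial := by
    rw [mF]; exact_mod_cast h
  have hk : (k.factorial : ℂ) ≠ 0 := by exact_mod_cast k.factorial_ne_zero
  rw [div_eq_div_iff (mF_ne α) hk, ← h', mP, map_prod, ← Finset.prod_mul_distrib]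
  simp only [map_pow, mul_pow]
  ring

/-- unnormalised coefficient -/
def mD {d : ℕ} (p w : Fin d → ℂ) (α : Fin d → ℕ) : ℂ :=
  ∑ i, (starRingEnd ℂ) (w i) * (p i * mP (fun j => -(starRingEnd ℂ) (p j)) α +
    mQ (fun j => -(starRingEnd ℂ) (p j)) i α)

/-- inner product -/
def ipc {d : ℕ} (p w : Fin d → ℂ) : ℂ := ∑ i, p i * (starRingEnd ℂ) (w i)

lemma mD_eq {d : ℕ} (p w : Fin d → ℂ) (α : Fin d → ℕ) :
    mD p w α = ipc p w * mP (fun j => -(starRingEnd ℂ) (p j)) α +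
      ∑ i, (starRingEnd ℂ) (w i) * mQ (fun j => -(starRingEnd ℂ) (p j)) i α := by
  rw [mD, ipc, Finset.sum_mul, ← Finset.sum_add_distrib]
  refine Finset.sum_congr rfl fun i _ => by ring

lemma mD_succ {d : ℕ} (p w : Fin d → ℂ) (i : Fin d) (β : Fin d → ℕ) :
    mD p w (β + Pi.single i 1) = -(starRingEnd ℂ) (p i) * mD p w β +
      (starRingEnd ℂ) (w i) * mP (fun j => -(starRingEnd ℂ) (p j)) β := by
  rw [mD_eq, mD_eq, mP_succ]
  simp only [mQ_succ, mul_add, Finset.sum_add_distrib, mul_ite, mul_zero, Finset.sum_ite_eq',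
    Finset.mem_univ, if_true, Finset.mul_sum]
  have : ∀ j, (starRingEnd ℂ) (w j) * (-(starRingEnd ℂ) (p i) * mQ (fun j => -(starRingEnd ℂ) (p j)) j β)
    = -(starRingEnd ℂ) (p i) * ((starRingEnd ℂ) (w j) * mQ (fun j => -(starRingEnd ℂ) (p j)) j β) :=
    fun j => by ring
  simp only [this]
  ring

/-- partial exponential -/
def eE (n : ℕ) (x : ℂ) : ℂ := ∑ k ∈ Finset.range (n + 1), x ^ k / k.factorial

lemma sum_E' {d n : ℕ} (p : Fin d → ℂ) :
    ∑ a : MIdx d n, mP (fun j => -(starRingEnd ℂ) (p j)) a.1 *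
      (starRingEnd ℂ) (mP (fun j => -(starRingEnd ℂ) (p j)) a.1) / mF a.1 = eE n (ipc p p) := by
  rw [sum_E, eE, ipc]
  refine Finset.sum_congr rfl fun k _ => ?_
  congr 3
  ext i; simp [mul_comm]

lemma sum_X {d n : ℕ} (p w : Fin d → ℂ) :
    ∑ a : MIdx d n, mD p w a.1 *
      (starRingEnd ℂ) (mP (fun j => -(starRingEnd ℂ) (p j)) a.1) / mF a.1 =
        ipc p w * ((ipc p p) ^ n / n.factorial) := by
  have key : ∀ a : Fin d → ℕ, mD p w a *
      (starRingEnd ℂ) (mP (fun j => -(starRingEnd ℂ) (p j)) a) / mF a =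
      ipc p w * (mP (fun j => -(starRingEnd ℂ) (p j)) a *
      (starRingEnd ℂ) (mP (fun j => -(starRingEnd ℂ) (p j)) a) / mF a) +
      ∑ i, (starRingEnd ℂ) (w i) * (mQ (fun j => -(starRingEnd ℂ) (p j)) i a *
        (starRingEnd ℂ) (mP (fun j => -(starRingEnd ℂ) (p j)) a) / mF a) := by
    intro a
    rw [mD_eq, add_mul, add_div, Finset.sum_mul, Finset.sum_div]
    congr 1
    · ring
    · exact Finset.sum_congr rfl fun i _ => by ring
  simp only [key]
  rw [Finset.sum_add_distrib, ← Finset.mul_sum, sum_E', Finset.sum_comm]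
  simp only [← Finset.mul_sum]
  rcases n with _ | n
  · have : ∀ i, ∑ a : MIdx d 0, (mQ (fun j => -(starRingEnd ℂ) (p j)) i a.1 *
        (starRingEnd ℂ) (mP (fun j => -(starRingEnd ℂ) (p j)) a.1) / mF a.1) = 0 := by
      intro i
      refine Finset.sum_eq_zero fun a _ => ?_
      have h0 : a.1 i = 0 := by
        have := a.2
        simp at this
        exact this i
      rw [mQ_eq, h0]; simp
    simp [this, eE]
  · have : ∀ i, ∑ a : MIdx d (n + 1), (mQ (fun j => -(starRingEnd ℂ) (p j)) i a.1 *
        (starRingEnd ℂ) (mP (fun j => -(starRingEnd ℂ) (p j)) a.1) / mF a.1) =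
        - p i * eE n (ipc p p) := by
      intro i
      rw [shift _ i n (fun a => (starRingEnd ℂ) (mP (fun j => -(starRingEnd ℂ) (p j)) a)), ← sum_E',
        Finset.mul_sum]
      refine Finset.sum_congr rfl fun b _ => ?_
      rw [mP_succ, map_mul, map_neg, Complex.conj_conj]
      ring
    simp only [this]
    have h2 : ∀ A : ℂ, ∑ i, (starRingEnd ℂ) (w i) * (-p i * A) = - ipc p w * A := by
      intro A
      rw [ipc, ← Finset.sum_neg_distrib, Finset.sum_mul]
      exact Finset.sum_congr rfl fun i _ => by ring
    rw [h2]
    simp only [eE]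
    rw [Finset.sum_range_succ _ (n + 1)]
    ring

lemma sum_N {d n : ℕ} (p w : Fin d → ℂ) :
    ∑ a : MIdx d (n + 1), mD p w a.1 * (starRingEnd ℂ) (mD p w a.1) / mF a.1 =
      ipc p w * (starRingEnd ℂ) (ipc p w) *
        ((ipc p p) ^ (n + 1) / (n + 1).factorial - (ipc p p) ^ n / n.factorial) +
      ipc w w * eE n (ipc p p) := by
  have hpp : (starRingEnd ℂ) (ipc p p) = ipc p p := by simp [ipc, mul_comm]
  have hX : ∀ m, ∑ a : MIdx d m, mP (fun j => -(starRingEnd ℂ) (p j)) a.1 *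
      (starRingEnd ℂ) (mD p w a.1) / mF a.1 =
        (starRingEnd ℂ) (ipc p w) * ((ipc p p) ^ m / m.factorial) := by
    intro m
    have h := congrArg (starRingEnd ℂ) (sum_X (n := m) p w)
    simp only [map_sum, map_div₀, map_mul, map_pow, hpp, Complex.conj_conj, map_natCast] at h
    rw [← h]
    refine Finset.sum_congr rfl fun a _ => ?_
    have : (starRingEnd ℂ) (mF a.1) = mF a.1 := by simp [mF]
    rw [this]; ring
  have key : ∀ a : Fin d → ℕ, mD p w a * (starRingEnd ℂ) (mD p w a) / mF a =
      ipc p w * (mP (fun j => -(starRingEnd ℂ) (p j)) a *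
      (starRingEnd ℂ) (mD p w a) / mF a) +
      ∑ i, (starRingEnd ℂ) (w i) * (mQ (fun j => -(starRingEnd ℂ) (p j)) i a *
        (starRingEnd ℂ) (mD p w a) / mF a) := by
    intro a
    nth_rewrite 1 [mD_eq]
    rw [add_mul, add_div, Finset.sum_mul, Finset.sum_div]
    congr 1
    · ring
    · exact Finset.sum_congr rfl fun i _ => by ring
  simp only [key]
  rw [Finset.sum_add_distrib, ← Finset.mul_sum, hX, Finset.sum_comm]
  simp only [← Finset.mul_sum]
  have : ∀ i, ∑ a : MIdx d (n + 1), (mQ (fun j => -(starRingEnd ℂ) (p j)) i a.1 *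
        (starRingEnd ℂ) (mD p w a.1) / mF a.1) =
        - p i * ((starRingEnd ℂ) (ipc p w) * ((ipc p p) ^ n / n.factorial)) +
          w i * eE n (ipc p p) := by
    intro i
    rw [shift _ i n (fun a => (starRingEnd ℂ) (mD p w a)), ← sum_E', ← hX,
        Finset.mul_sum, Finset.mul_sum, ← Finset.sum_add_distrib]
    refine Finset.sum_congr rfl fun b _ => ?_
    rw [mD_succ, map_add, map_mul, map_mul, map_neg, Complex.conj_conj, Complex.conj_conj]
    ring
  simp only [this]
  have h2 : ∀ A B : ℂ, ∑ i, (starRingEnd ℂ) (w i) * (-p i * A + w i * B) =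
      - ipc p w * A + ipc w w * B := by
    intro A B
    rw [ipc, ipc, ← Finset.sum_neg_distrib, Finset.sum_mul, Finset.sum_mul, ← Finset.sum_add_distrib]
    exact Finset.sum_congr rfl fun i _ => by ring
  rw [h2]
  ring

lemma exp_tail (n : ℕ) (x : ℝ) (hx : 0 ≤ x) :
    Real.exp x - ∑ k ∈ Finset.range n, x ^ k / k.factorial ≤ x ^ n / n.factorial * Real.exp x := by
  have hs : HasSum (fun k : ℕ => x ^ k / k.factorial) (Real.exp x) := by
    rw [Real.exp_eq_exp_ℝ]
    exact NormedSpace.expSeries_div_hasSum_exp _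
  have h1 := hs.summable.sum_add_tsum_nat_add n
  rw [hs.tsum_eq] at h1
  rw [← h1, add_sub_cancel_left, h1, ← hs.tsum_eq, ← tsum_mul_left]
  refine Summable.tsum_le_tsum (fun m => ?_) ((summable_nat_add_iff n).mpr hs.summable)
    (hs.summable.mul_left _)
  rw [div_mul_div_comm, ← pow_add, add_comm n m]
  refine div_le_div_of_nonneg_left (by positivity) (by positivity) ?_
  rw [mul_comm]
  exact_mod_cast Nat.le_of_dvd (Nat.factorial_pos _) (Nat.factorial_mul_factorial_dvd_factorial_add m n)

/-- weight -/
def rho {d : ℕ} (z : Fin d → ℂ) : ℝ := Real.exp (-(∑ i, ‖z i‖ ^ 2))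

lemma rho_prod {d : ℕ} (z : Fin d → ℂ) : (rho z : ℂ) = ∏ i, (Real.exp (-‖z i‖ ^ 2) : ℂ) := by
  rw [rho, ← Finset.sum_neg_distrib, Real.exp_sum]; push_cast; rfl

lemma rho_nonneg {d : ℕ} (z : Fin d → ℂ) : 0 ≤ rho z := (Real.exp_pos _).le

lemma rho_cont {d : ℕ} : Continuous (rho (d := d)) := by unfold rho; fun_prop

lemma integral_muE {d : ℕ} (f : Fin d → ℂ → ℂ) :
    ∫ z, ∏ i, f i (z i) ∂(μE d) = ∏ i, ((Real.pi : ℂ)⁻¹ * ∫ z, f i z) := by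
  rw [μE, integral_smul_measure, integral_fintype_prod_volume_eq_prod, Finset.prod_mul_distrib]
  simp [ENNReal.toReal_ofReal Real.pi_pos.le]

lemma integrable_muE {d : ℕ} {f : (Fin d → ℂ) → ℂ} (h : Integrable f) : Integrable f (μE d) := by
  rw [μE]
  refine h.smul_measure ?_
  simp [Real.pi_pos]

/-- normalising constant -/
def kU {d : ℕ} (p : Fin d → ℂ) (α : Fin d → ℕ) : ℝ :=
  Real.exp (-(∑ i, ‖p i‖ ^ 2) / 2) / Real.sqrt (∏ i, (α i).factorial)

lemma uFn_eq {d : ℕ} (p : Fin d → ℂ) (α : Fin d → ℕ) (z : Fin d → ℂ) :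
    uFn p α z = kU p α * ∏ i, v1 (p i) (α i) (z i) := by
  simp only [uFn, kU, v1]
  rw [Finset.prod_mul_distrib, ← Complex.exp_sum]; ring

lemma kU_sq {d : ℕ} (p : Fin d → ℂ) (α : Fin d → ℕ) :
    (kU p α : ℂ) * kU p α = Real.exp (-(∑ i, ‖p i‖ ^ 2)) / mF α := by
  have : kU p α * kU p α = Real.exp (-(∑ i, ‖p i‖ ^ 2)) / (∏ i, (α i).factorial : ℕ) := by
    rw [kU, div_mul_div_comm, Real.mul_self_sqrt (by positivity), ← Real.exp_add]
    congr 1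
    · congr 1; ring
    · push_cast; rfl
  rw [← Complex.ofReal_mul, this, mF]; push_cast; rfl

lemma uFn_cont {d : ℕ} (p : Fin d → ℂ) (α : Fin d → ℕ) : Continuous (uFn p α) := by
  unfold uFn; fun_prop

lemma pair_uu {d : ℕ} (p : Fin d → ℂ) (α β : Fin d → ℕ) (z : Fin d → ℂ) :
    uFn p α z * (starRingEnd ℂ) (uFn p β z) * (rho z : ℂ) = (kU p α * kU p β : ℂ) *
      ∏ i, (v1 (p i) (α i) (z i) * (starRingEnd ℂ) (v1 (p i) (β i) (z i)) *
        (Real.exp (-‖z i‖ ^ 2) : ℂ)) := by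
  rw [uFn_eq, uFn_eq, rho_prod, map_mul, map_prod, Complex.conj_ofReal, Finset.prod_mul_distrib,
    Finset.prod_mul_distrib]
  ring

lemma pair_uu_int {d : ℕ} (p : Fin d → ℂ) (α β : Fin d → ℕ) :
    Integrable (fun z => uFn p α z * (starRingEnd ℂ) (uFn p β z) * (rho z : ℂ)) (μE d) := by
  simp only [pair_uu]
  refine Integrable.const_mul (integrable_muE ?_) _
  exact Integrable.fintype_prod (f := fun i z => v1 (p i) (α i) z * (starRingEnd ℂ) (v1 (p i) (β i) z) *
        (Real.exp (-‖z‖ ^ 2) : ℂ)) (fun i => D4 _ _ _)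

lemma orth {d : ℕ} (p : Fin d → ℂ) (α β : Fin d → ℕ) :
    ∫ z, uFn p α z * (starRingEnd ℂ) (uFn p β z) * (rho z : ℂ) ∂(μE d) =
      if α = β then 1 else 0 := by
  simp only [pair_uu]
  rw [integral_const_mul, integral_muE (fun i z => v1 (p i) (α i) z * (starRingEnd ℂ) (v1 (p i) (β i) z) *
        (Real.exp (-‖z‖ ^ 2) : ℂ))]
  have hpi : (Real.pi : ℂ) ≠ 0 := by exact_mod_cast Real.pi_ne_zero
  split_ifs with h
  · subst h
    have : ∀ i, (Real.pi : ℂ)⁻¹ * (∫ z : ℂ, v1 (p i) (α i) z *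
        (starRingEnd ℂ) (v1 (p i) (α i) z) * (Real.exp (-‖z‖ ^ 2) : ℂ)) =
        (α i).factorial * (Real.exp (‖p i‖ ^ 2) : ℂ) := by
      intro i; rw [D3, if_pos rfl]; field_simp
    simp only [this]
    rw [kU_sq, Finset.prod_mul_distrib, ← Complex.ofReal_prod, ← Real.exp_sum, ← mF]
    have h1 := mF_ne α
    have h2 : (Real.exp (-(∑ i, ‖p i‖ ^ 2)) : ℂ) * (Real.exp (∑ i, ‖p i‖ ^ 2) : ℂ) = 1 := by
      rw [← Complex.ofReal_mul, ← Real.exp_add]; simp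
    field_simp
    exact h2
  · obtain ⟨i, hi⟩ := Function.ne_iff.mp h
    rw [Finset.prod_eq_zero (Finset.mem_univ i), mul_zero]
    rw [D3, if_neg hi, mul_zero]

/-- square-integrable continuous functions -/
def SF {d : ℕ} (h : (Fin d → ℂ) → ℂ) : Prop :=
  Continuous h ∧ Integrable (fun z => ‖h z‖ ^ 2 * rho z) (μE d)

lemma norm_sq_rho {d : ℕ} (h : (Fin d → ℂ) → ℂ) (z : Fin d → ℂ) :
    ((‖h z‖ ^ 2 * rho z : ℝ) : ℂ) = h z * (starRingEnd ℂ) (h z) * (rho z : ℂ) := by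
  rw [Complex.mul_conj']; push_cast; rfl

lemma SF_of {d : ℕ} {h : (Fin d → ℂ) → ℂ} (hc : Continuous h)
    (hi : Integrable (fun z => h z * (starRingEnd ℂ) (h z) * (rho z : ℂ)) (μE d)) : SF h := by
  refine ⟨hc, ?_⟩
  simp only [← norm_sq_rho] at hi
  exact hi.re

lemma SF.pair {d : ℕ} {h g : (Fin d → ℂ) → ℂ} (hh : SF h) (hg : SF g) :
    Integrable (fun z => h z * (starRingEnd ℂ) (g z) * (rho z : ℂ)) (μE d) := by
  have h1 := hh.1
  have h2 := hg.1
  have h3 := rho_cont (d := d)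
  refine Integrable.mono' (hh.2.add hg.2) (Continuous.aestronglyMeasurable (by fun_prop))
    (.of_forall fun z => ?_)
  simp only [norm_mul, RCLike.norm_conj, Complex.norm_real, Real.norm_eq_abs,
    abs_of_nonneg (rho_nonneg z), Pi.add_apply]
  rw [← add_mul]
  refine mul_le_mul_of_nonneg_right ?_ (rho_nonneg z)
  nlinarith [sq_nonneg (‖h z‖ - ‖g z‖), sq_nonneg (‖h z‖), sq_nonneg (‖g z‖)]

lemma SF_u {d : ℕ} (p : Fin d → ℂ) (α : Fin d → ℕ) : SF (uFn p α) :=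
  SF_of (uFn_cont p α) (pair_uu_int p α α)

lemma SF.smul {d : ℕ} {h : (Fin d → ℂ) → ℂ} (hh : SF h) (c : ℂ) : SF (fun z => c * h z) := by
  refine ⟨continuous_const.mul hh.1, ?_⟩
  refine (hh.2.const_mul (‖c‖ ^ 2)).congr (.of_forall fun z => ?_)
  simp only [norm_mul]; ring

lemma SF.add {d : ℕ} {h g : (Fin d → ℂ) → ℂ} (hh : SF h) (hg : SF g) :
    SF (fun z => h z + g z) := by
  refine SF_of (hh.1.add hg.1) ?_
  refine (((hh.pair hh).add (hh.pair hg)).add ((hg.pair hh).add (hg.pair hg))).congr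
    (.of_forall fun z => ?_)
  simp only [Pi.add_apply, map_add]; ring

lemma SF_zero {d : ℕ} : SF (fun _ : Fin d → ℂ => (0:ℂ)) := ⟨continuous_const, by simp⟩

lemma SF_sum {d : ℕ} {ι : Type*} (s : Finset ι) (h : ι → (Fin d → ℂ) → ℂ)
    (hh : ∀ i, SF (h i)) : SF (fun z => ∑ i ∈ s, h i z) := by
  classical
  induction s using Finset.induction_on with
  | empty => simpa using SF_zero
  | insert a s ha ih =>
    simp only [Finset.sum_insert ha]
    exact (hh a).add ih

lemma inner_sum_left {d : ℕ} {ι : Type*} [Fintype ι] (c : ι → ℂ) (h : ι → (Fin d → ℂ) → ℂ)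
    (hh : ∀ i, SF (h i)) {g : (Fin d → ℂ) → ℂ} (hg : SF g) :
    fockInner (fun z => ∑ i, c i * h i z) g = ∑ i, c i * fockInner (h i) g := by
  simp only [fockInner, ← integral_const_mul]
  rw [← integral_finsetSum]
  · congr 1; ext z
    rw [Finset.sum_mul, Finset.sum_mul]
    exact Finset.sum_congr rfl fun i _ => by ring
  · intro i _
    exact ((hh i).pair hg).const_mul _

lemma inner_conj {d : ℕ} (h g : (Fin d → ℂ) → ℂ) :
    fockInner h g = (starRingEnd ℂ) (fockInner g h) := by
  rw [fockInner, fockInner, ← integral_conj]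
  congr 1; ext z
  simp only [map_mul, Complex.conj_conj, Complex.conj_ofReal]; ring

lemma inner_sum_right {d : ℕ} {ι : Type*} [Fintype ι] (c : ι → ℂ) (h : ι → (Fin d → ℂ) → ℂ)
    (hh : ∀ i, SF (h i)) {g : (Fin d → ℂ) → ℂ} (hg : SF g) :
    fockInner g (fun z => ∑ i, c i * h i z) = ∑ i, (starRingEnd ℂ) (c i) * fockInner g (h i) := by
  rw [inner_conj, inner_sum_left c h hh hg, map_sum]
  refine Finset.sum_congr rfl fun i _ => ?_
  rw [map_mul, ← inner_conj]

lemma inner_sub_left {d : ℕ} {h k g : (Fin d → ℂ) → ℂ} (hh : SF h) (hk : SF k) (hg : SF g) :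
    fockInner (fun z => h z - k z) g = fockInner h g - fockInner k g := by
  have h1 := integral_sub (hh.pair hg) (hk.pair hg)
  refine Eq.trans ?_ h1
  rw [fockInner]
  congr 1; ext z
  rw [rho]; ring

lemma inner_sub_right {d : ℕ} {h k g : (Fin d → ℂ) → ℂ} (hh : SF h) (hk : SF k) (hg : SF g) :
    fockInner g (fun z => h z - k z) = fockInner g h - fockInner g k := by
  rw [inner_conj, inner_sub_left hh hk hg, map_sub, ← inner_conj, ← inner_conj]

lemma norm_sq_inner {d : ℕ} (h : (Fin d → ℂ) → ℂ) :
    ((∫ z, ‖h z‖ ^ 2 * rho z ∂(μE d) : ℝ) : ℂ) = fockInner h h := by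
  rw [← integral_complex_ofReal, fockInner]
  congr 1; ext z
  rw [norm_sq_rho]; rfl

lemma fock_orth {d : ℕ} (p : Fin d → ℂ) (α β : Fin d → ℕ) :
    fockInner (uFn p α) (uFn p β) = if α = β then 1 else 0 := orth p α β

lemma proj_err {d : ℕ} (n : ℕ) (p : Fin d → ℂ) {g : (Fin d → ℂ) → ℂ} (hg : SF g) :
    fockInner (fun z => jetProj n p g z - g z) (fun z => jetProj n p g z - g z) =
      fockInner g g - ∑ a : MIdx d n, fockInner g (uFn p a.1) *
        (starRingEnd ℂ) (fockInner g (uFn p a.1)) := by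
  have hu : ∀ a : MIdx d n, SF (uFn p a.1) := fun a => SF_u p a.1
  have hP : SF (jetProj n p g) := SF_sum _ _ fun a => (hu a).smul _
  have hd : SF (fun z => jetProj n p g z - g z) := by
    simpa [sub_eq_add_neg] using hP.add (hg.smul (-1))
  rw [inner_sub_left hP hg hd, inner_sub_right hP hg hP, inner_sub_right hP hg hg]
  have h1 : fockInner (jetProj n p g) g = ∑ a : MIdx d n, fockInner g (uFn p a.1) *
        (starRingEnd ℂ) (fockInner g (uFn p a.1)) := by
    unfold jetProj
    rw [inner_sum_left _ _ hu hg]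
    refine Finset.sum_congr rfl fun a _ => ?_
    rw [← inner_conj]
  have h2 : fockInner g (jetProj n p g) = ∑ a : MIdx d n, fockInner g (uFn p a.1) *
        (starRingEnd ℂ) (fockInner g (uFn p a.1)) := by
    unfold jetProj
    rw [inner_sum_right _ _ hu hg]
    refine Finset.sum_congr rfl fun a _ => mul_comm _ _
  have h3 : fockInner (jetProj n p g) (jetProj n p g) = ∑ a : MIdx d n, fockInner g (uFn p a.1) *
        (starRingEnd ℂ) (fockInner g (uFn p a.1)) := by
    have e : fockInner (jetProj n p g) (jetProj n p g) =
        fockInner (fun z => ∑ a : MIdx d n, fockInner g (uFn p a.1) * uFn p a.1 z)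
          (jetProj n p g) := rfl
    rw [e, inner_sum_left _ _ hu hP]
    refine Finset.sum_congr rfl fun a _ => ?_
    congr 1
    unfold jetProj
    rw [inner_sum_right _ _ hu (hu a)]
    simp only [fock_orth]
    rw [Finset.sum_eq_single a]
    · simp
    · intro b _ hb
      rw [if_neg, mul_zero]
      intro hab
      exact hb (Subtype.ext hab.symm)
    · simp
  rw [h1, h2, h3]
  ring

lemma coord_eq {d : ℕ} (i : Fin d) (z : Fin d → ℂ) : uFn 0 (Pi.single i 1) z = z i := by
  have h1 : ∏ j, ((Pi.single i 1 : Fin d → ℕ) j).factorial = 1 := by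
    refine Finset.prod_eq_one fun j _ => ?_
    by_cases h : j = i
    · subst h; simp
    · simp [h]
  have h2 : ∏ j, z j ^ ((Pi.single i 1 : Fin d → ℕ) j) = z i := by
    rw [Finset.prod_eq_single i] <;> simp +contextual
  have h3 : ∏ j, (((Pi.single i 1 : Fin d → ℕ) j).factorial : ℝ) = 1 := by exact_mod_cast h1
  simp [uFn, h2, h3]

lemma SF_coord {d : ℕ} (i : Fin d) : SF (fun z : Fin d → ℂ => z i) := by
  have := SF_u (0 : Fin d → ℂ) (Pi.single i 1)
  simpa only [funext (coord_eq i)] using this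

lemma ell_eq {d : ℕ} (w : Fin d → ℂ) : (fun z : Fin d → ℂ => ∑ i, z i * (starRingEnd ℂ) (w i)) =
    fun z => ∑ i, (starRingEnd ℂ) (w i) * z i := by
  ext z; exact Finset.sum_congr rfl fun i _ => mul_comm _ _

lemma SF_ell {d : ℕ} (w : Fin d → ℂ) :
    SF (fun z : Fin d → ℂ => ∑ i, z i * (starRingEnd ℂ) (w i)) := by
  rw [ell_eq]
  exact SF_sum _ _ fun i => (SF_coord i).smul _

lemma inner_coord {d : ℕ} (i j : Fin d) :
    fockInner (fun z : Fin d → ℂ => z i) (fun z : Fin d → ℂ => z j) = if i = j then 1 else 0 := by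
  have := fock_orth (0 : Fin d → ℂ) (Pi.single i 1) (Pi.single j 1)
  rw [funext (coord_eq i), funext (coord_eq j)] at this
  rw [this]
  by_cases h : i = j
  · simp [h]
  · rw [if_neg h, if_neg]
    intro h'
    have := congrFun h' i
    simp [h] at this

lemma inner_ell {d : ℕ} (w : Fin d → ℂ) :
    fockInner (fun z : Fin d → ℂ => ∑ i, z i * (starRingEnd ℂ) (w i))
      (fun z : Fin d → ℂ => ∑ i, z i * (starRingEnd ℂ) (w i)) = ipc w w := by
  have hs := SF_ell w
  rw [ell_eq] at hs ⊢
  rw [inner_sum_left _ (fun i z => z i) SF_coord hs, ipc]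
  refine Finset.sum_congr rfl fun i _ => ?_
  rw [inner_sum_right _ (fun i z => z i) SF_coord (SF_coord i)]
  simp [inner_coord, mul_comm]

lemma coef_coord {d : ℕ} (p : Fin d → ℂ) (α : Fin d → ℕ) (i : Fin d) :
    fockInner (fun z : Fin d → ℂ => z i) (uFn p α) = kU p α *
      (p i * mP (fun j => -(starRingEnd ℂ) (p j)) α +
        mQ (fun j => -(starRingEnd ℂ) (p j)) i α) := by
  have hpi : (Real.pi : ℂ) ≠ 0 := by exact_mod_cast Real.pi_ne_zero
  have e : ∀ z : Fin d → ℂ, z i * (starRingEnd ℂ) (uFn p α z) * (rho z : ℂ) = (kU p α : ℂ) *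
      ∏ j, ((if j = i then z j else 1) * (starRingEnd ℂ) (v1 (p j) (α j) (z j)) *
        (Real.exp (-‖z j‖ ^ 2) : ℂ)) := by
    intro z
    rw [uFn_eq, rho_prod, map_mul, map_prod, Complex.conj_ofReal, Finset.prod_mul_distrib,
      Finset.prod_mul_distrib, Finset.prod_ite_eq' Finset.univ i, if_pos (Finset.mem_univ i)]
    ring
  have e0 : fockInner (fun z : Fin d → ℂ => z i) (uFn p α) =
    ∫ z, z i * (starRingEnd ℂ) (uFn p α z) * (rho z : ℂ) ∂(μE d) := rfl
  rw [e0]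
  simp only [e]
  rw [integral_const_mul, integral_muE (fun j z => (if j = i then z else 1) *
    (starRingEnd ℂ) (v1 (p j) (α j) z) * (Real.exp (-‖z‖ ^ 2) : ℂ))]
  congr 1
  rw [← Finset.mul_prod_erase _ _ (Finset.mem_univ i), mQ_eq, mP,
    ← Finset.mul_prod_erase _ _ (Finset.mem_univ i)]
  have h1 : ∏ j ∈ Finset.univ.erase i, ((Real.pi : ℂ)⁻¹ * ∫ z, (if j = i then z else 1) *
      (starRingEnd ℂ) (v1 (p j) (α j) z) * (Real.exp (-‖z‖ ^ 2) : ℂ)) =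
      ∏ j ∈ Finset.univ.erase i, (-(starRingEnd ℂ) (p j)) ^ α j := by
    refine Finset.prod_congr rfl fun j hj => ?_
    simp only [if_neg (Finset.ne_of_mem_erase hj), one_mul]
    rw [D1]; field_simp
  rw [h1]
  simp only [if_true]
  rw [D2]
  field_simp

lemma coef_ell {d : ℕ} (p w : Fin d → ℂ) (α : Fin d → ℕ) :
    fockInner (fun z : Fin d → ℂ => ∑ i, z i * (starRingEnd ℂ) (w i)) (uFn p α) =
      kU p α * mD p w α := by
  rw [ell_eq, inner_sum_left _ (fun i z => z i) SF_coord (SF_u p α), mD, Finset.mul_sum]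
  refine Finset.sum_congr rfl fun i _ => ?_
  rw [coef_coord]; ring

lemma ipc_self {d : ℕ} (p : Fin d → ℂ) : ipc p p = ((∑ i, ‖p i‖ ^ 2 : ℝ) : ℂ) := by
  rw [ipc]; push_cast
  exact Finset.sum_congr rfl fun i _ => Complex.mul_conj' _

lemma ipc_cs {d : ℕ} (p w : Fin d → ℂ) :
    ‖ipc p w‖ ^ 2 ≤ (∑ i, ‖p i‖ ^ 2) * ∑ i, ‖w i‖ ^ 2 := by
  have h1 : ‖ipc p w‖ ≤ ∑ i, ‖p i‖ * ‖w i‖ := by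
    refine (norm_sum_le _ _).trans (le_of_eq ?_)
    simp
  calc _ ≤ (∑ i, ‖p i‖ * ‖w i‖) ^ 2 := by gcongr
    _ ≤ _ := Finset.sum_mul_sq_le_sq_mul_sq _ _ _

/-- exact error formula -/
lemma err_formula {d : ℕ} (p w : Fin d → ℂ) (n : ℕ) :
    (∫ z, ‖jetProj (n + 1) p (fun z' => ∑ i, z' i * (starRingEnd ℂ) (w i)) z -
          ∑ i, z i * (starRingEnd ℂ) (w i)‖ ^ 2 *
        Real.exp (-(∑ i, ‖z i‖ ^ 2)) ∂(μE d)) =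
      (∑ i, ‖w i‖ ^ 2) - Real.exp (-(∑ i, ‖p i‖ ^ 2)) * (‖ipc p w‖ ^ 2 *
        ((∑ i, ‖p i‖ ^ 2) ^ (n + 1) / (n + 1).factorial - (∑ i, ‖p i‖ ^ 2) ^ n / n.factorial) +
        (∑ i, ‖w i‖ ^ 2) * ∑ k ∈ Finset.range (n + 1), (∑ i, ‖p i‖ ^ 2) ^ k / k.factorial) := by
  have h := norm_sq_inner (fun z => jetProj (n + 1) p (fun z' => ∑ i, z' i * (starRingEnd ℂ) (w i)) z -
          ∑ i, z i * (starRingEnd ℂ) (w i))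
  rw [proj_err (n + 1) p (SF_ell w), inner_ell] at h
  have h2 : ∑ a : MIdx d (n + 1),
      fockInner (fun z : Fin d → ℂ => ∑ i, z i * (starRingEnd ℂ) (w i)) (uFn p a.1) *
        (starRingEnd ℂ) (fockInner (fun z : Fin d → ℂ => ∑ i, z i * (starRingEnd ℂ) (w i))
          (uFn p a.1)) = Real.exp (-(∑ i, ‖p i‖ ^ 2)) *
        ∑ a : MIdx d (n + 1), mD p w a.1 * (starRingEnd ℂ) (mD p w a.1) / mF a.1 := by
    rw [Finset.mul_sum]
    refine Finset.sum_congr rfl fun a _ => ?_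
    rw [coef_ell, map_mul, Complex.conj_ofReal]
    linear_combination mD p w a.1 * (starRingEnd ℂ) (mD p w a.1) * kU_sq p a.1
  rw [h2, sum_N, Complex.mul_conj', eE, ipc_self, ipc_self] at h
  exact_mod_cast h

/-- jet projection error for linear functions. -/
theorem statement15 (d : ℕ) (p w : Fin d → ℂ) (n : ℕ) (hn : 1 ≤ n) :
    MemFock (fun z => ∑ i, z i * (starRingEnd ℂ) (w i)) ∧
    (∫ z, ‖jetProj n p (fun z' => ∑ i, z' i * (starRingEnd ℂ) (w i)) z -
          ∑ i, z i * (starRingEnd ℂ) (w i)‖ ^ 2 *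
        Real.exp (-(∑ i, ‖z i‖ ^ 2)) ∂(μE d)) ≤
      (1 + d) * (1 + 2 * d) * (∑ i, ‖w i‖ ^ 2) *
        ((∑ i, ‖p i‖ ^ 2) ^ n / (n - 1).factorial) := by
  have hS := SF_ell w
  refine ⟨⟨by fun_prop, hS.2⟩, ?_⟩
  obtain ⟨n, rfl⟩ : ∃ m, n = m + 1 := ⟨n - 1, by omega⟩
  rw [err_formula, Nat.add_sub_cancel]
  rcases Nat.eq_zero_or_pos d with rfl | hd
  · simp [ipc]
  have hcs := ipc_cs p w
  set x : ℝ := ∑ i, ‖p i‖ ^ 2 with hx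
  set W : ℝ := ∑ i, ‖w i‖ ^ 2 with hW
  have hx0 : 0 ≤ x := by positivity
  have hW0 : 0 ≤ W := by positivity
  have ht := exp_tail (n + 1) x hx0
  set E : ℝ := ∑ k ∈ Finset.range (n + 1), x ^ k / k.factorial with hE
  have hee : Real.exp (-x) * Real.exp x = 1 := by rw [← Real.exp_add]; simp
  have he1 : Real.exp (-x) ≤ 1 := Real.exp_le_one_iff.mpr (by linarith)
  have he0 : 0 < Real.exp (-x) := Real.exp_pos _
  set B : ℝ := x ^ (n + 1) / n.factorial with hB
  have hB0 : 0 ≤ B := by positivity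
  have hA : x ^ (n + 1) / (n + 1).factorial ≤ B := by
    refine div_le_div_of_nonneg_left (by positivity) (by positivity) ?_
    exact_mod_cast Nat.factorial_le (Nat.le_succ n)
  have hA0 : 0 ≤ x ^ (n + 1) / (n + 1).factorial := by positivity
  set A : ℝ := x ^ (n + 1) / (n + 1).factorial with hAd
  have hC : ‖ipc p w‖ ^ 2 * (x ^ n / n.factorial) ≤ W * B := by
    calc _ ≤ (x * W) * (x ^ n / n.factorial) := by gcongr
      _ = W * B := by rw [hB]; ring
  have hC0 : 0 ≤ ‖ipc p w‖ ^ 2 * (x ^ n / n.factorial) := by positivity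
  have h1 : 1 - Real.exp (-x) * E ≤ A := by
    have := mul_le_mul_of_nonneg_left ht he0.le
    rw [mul_sub, hee] at this
    calc _ ≤ _ := this
      _ = A * (Real.exp (-x) * Real.exp x) := by ring
      _ = A := by rw [hee, mul_one]
  have h2 : W * (1 - Real.exp (-x) * E) ≤ W * B := mul_le_mul_of_nonneg_left (h1.trans hA) hW0
  have h3 : Real.exp (-x) * (‖ipc p w‖ ^ 2 * (x ^ n / n.factorial)) ≤ W * B :=
    (mul_le_of_le_one_left hC0 he1).trans hC
  have h4 : 0 ≤ Real.exp (-x) * (‖ipc p w‖ ^ 2 * A) := by positivity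
  have hd1 : (1:ℝ) ≤ d := by exact_mod_cast hd
  have hWB : 0 ≤ W * B := by positivity
  have h5 : (2:ℝ) * (W * B) ≤ ((1 + d) * (1 + 2 * d)) * (W * B) := by
    refine mul_le_mul_of_nonneg_right ?_ hWB
    nlinarith
  calc _ = W * (1 - Real.exp (-x) * E) + Real.exp (-x) * (‖ipc p w‖ ^ 2 * (x ^ n / n.factorial))
        - Real.exp (-x) * (‖ipc p w‖ ^ 2 * A) := by ring
    _ ≤ 2 * (W * B) := by linarith
    _ ≤ _ := h5
    _ = _ := by ring

end PFA
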